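/- arXiv:2107.08153 — 9 statements merged into one kernel-verified Lean document; each statement's English description precedes it below -/
import Mathlib

section
/- Let u : ℝ^m → ℝ be continuous, concave on the nonnegative orthant, positively homogeneous of degree 1 there (u(λx) = λ·u(x) for all λ > 0 and x ≥ 0), nonnegative on the nonnegative orthant, and satisfy u(x̂) > 0 for some x̂ ≥ 0. Let p ∈ ℝ^m have strictly positive entries and let b > 0. Then sup { b·log(u(x)) : x ∈ ℝ^m, x ≥ 0, u(x) > 0, p·x ≤ b } = sup { b·log(u(x)) + b − p·x : x ∈ ℝ^m, x ≥ 0, u(x) > 0 }. -/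
/-- For a continuous, concave (on the nonnegative orthant), positively
homogeneous of degree 1, nonnegative utility `u` that is positive somewhere on the
nonnegative orthant, strictly positive prices `p` and budget `b > 0`, the constrained
utility-maximization value equals the value of the unconstrained Lagrangian form. -/
theorem eg_umu_unconstrained_equiv (m : ℕ) (u : (Fin m → ℝ) → ℝ) (p : Fin m → ℝ) (b : ℝ)
    (hu_cont : Continuous u)
    (hu_conc : ConcaveOn ℝ {x : Fin m → ℝ | ∀ j, 0 ≤ x j} u)
    (hu_hom : ∀ c : ℝ, 0 < c → ∀ x : Fin m → ℝ, (∀ j, 0 ≤ x j) → u (c • x) = c * u x)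
    (hu_nonneg : ∀ x : Fin m → ℝ, (∀ j, 0 ≤ x j) → 0 ≤ u x)
    (hu_pos : ∃ xhat : Fin m → ℝ, (∀ j, 0 ≤ xhat j) ∧ 0 < u xhat)
    (hp : ∀ j, 0 < p j) (hb : 0 < b) :
    sSup {y : ℝ | ∃ x : Fin m → ℝ, (∀ j, 0 ≤ x j) ∧ 0 < u x ∧
        (∑ j, p j * x j) ≤ b ∧ y = b * Real.log (u x)} =
    sSup {y : ℝ | ∃ x : Fin m → ℝ, (∀ j, 0 ≤ x j) ∧ 0 < u x ∧
        y = b * Real.log (u x) + b - ∑ j, p j * x j} := by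
  apply csSup_eq_csSup_of_forall_exists_le
  · rintro _ ⟨x, hx, hux, hpx, rfl⟩
    exact ⟨_, ⟨x, hx, hux, rfl⟩, by linarith⟩
  · rintro _ ⟨x, hx, hux, rfl⟩
    have h_zero : u 0 = 0 := by
      have h := hu_hom 2 two_pos 0 (fun _ => le_rfl)
      rw [smul_zero] at h
      linarith
    obtain ⟨i, hi⟩ : ∃ i, x i ≠ 0 :=
      Function.ne_iff.mp (show x ≠ 0 by rintro rfl; exact hux.ne' h_zero)
    have h_cost : 0 < ∑ j, p j * x j :=
      Finset.sum_pos' (fun j _ => mul_nonneg (hp j).le (hx j))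
        ⟨i, Finset.mem_univ i, mul_pos (hp i) ((hx i).lt_of_ne' hi)⟩
    set s := ∑ j, p j * x j with hs
    have hc : 0 < b / s := div_pos hb h_cost
    have hu_scaled : u ((b / s) • x) = b / s * u x := hu_hom _ hc x hx
    refine ⟨_, ⟨(b / s) • x, fun j => mul_nonneg hc.le (hx j), ?_, ?_, rfl⟩, ?_⟩
    · rw [hu_scaled]
      exact mul_pos hc hux
    · have h_sum : ∑ j, p j * ((b / s) • x) j = b / s * s := by
        rw [hs, Finset.mul_sum]
        exact Finset.sum_congr rfl fun j _ => mul_left_comm _ _ _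
      rw [h_sum, div_mul_cancel₀ _ h_cost.ne']
    · rw [hu_scaled, Real.log_mul hc.ne' hux.ne']
      have h_log : 1 - s / b ≤ Real.log (b / s) := by
        simpa only [inv_div] using Real.one_sub_inv_le_log_of_pos hc
      have h_scaled := mul_le_mul_of_nonneg_left h_log hb.le
      rw [mul_sub, mul_div_cancel₀ _ hb.ne'] at h_scaled
      linarith
end

section
/- Consider n buyers with utility functions u_i : ℝ^m → ℝ, each continuous, concave on the nonnegative orthant, positively homogeneous of degree 1 there, nonnegative on the nonnegative orthant and positive at some nonnegative bundle, and budgets b_i > 0. For every p ∈ ℝ^m with strictly positive entries, the value of the Lagrangian dual function of the Eisenberg–Gale program at p satisfies: sup over all x_1, …, x_n ∈ ℝ^m with x_i ≥ 0 and u_i(x_i) > 0 of [ Σ_{i=1}^n b_i·log(u_i(x_i)) + Σ_{j=1}^m p_j·(1 − Σ_{i=1}^n x_{ij}) ] = Σ_{j=1}^m p_j + Σ_{i=1}^n ( b_i·log(v_i(p, b_i)) − b_i ), where v_i(p, b) = sup { u_i(x) : x ≥ 0, p·x ≤ b } is the indirect utility function of buyer i. -/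
/-- The indirect utility function `v(p, b) = sup { u(x) : x ≥ 0, p·x ≤ b }`. -/
noncomputable def indirectUtil {m : ℕ} (u : (Fin m → ℝ) → ℝ) (p : Fin m → ℝ) (b : ℝ) : ℝ :=
  sSup {c : ℝ | ∃ x : Fin m → ℝ, (∀ j, 0 ≤ x j) ∧ (∑ j, p j * x j) ≤ b ∧ c = u x}

/-- The budget set at strictly positive prices is compact. -/
theorem isCompact_budgetSet {m : ℕ} {p : Fin m → ℝ} (hp : ∀ j, 0 < p j) (b : ℝ) :
    IsCompact {x : Fin m → ℝ | (∀ j, 0 ≤ x j) ∧ ∑ j, p j * x j ≤ b} := by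
  refine (isCompact_univ_pi fun j => isCompact_Icc (a := (0 : ℝ)) (b := b / p j)).of_isClosed_subset
    ?_ ?_
  · have hsum : Continuous fun x : Fin m → ℝ => ∑ j, p j * x j := by fun_prop
    have hnonneg : IsClosed {x : Fin m → ℝ | ∀ j, 0 ≤ x j} := by
      simp only [Set.ofPred_forall]
      exact isClosed_iInter fun j => isClosed_le continuous_const (continuous_apply j)
    exact hnonneg.inter (isClosed_le hsum continuous_const)
  · rintro x ⟨hx, hxb⟩ j -
    refine ⟨hx j, (le_div_iff₀' (hp j)).2 (le_trans ?_ hxb)⟩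
    exact Finset.single_le_sum (f := fun j => p j * x j)
      (fun k _ => mul_nonneg (hp k).le (hx k)) (Finset.mem_univ j)

theorem sum_mul_smul_apply {m : ℕ} (p x : Fin m → ℝ) (c : ℝ) :
    ∑ j, p j * (c • x) j = c * ∑ j, p j * x j := by
  rw [Finset.mul_sum]
  exact Finset.sum_congr rfl fun j _ => by simp only [Pi.smul_apply, smul_eq_mul]; ring

/-- A bundle of positive utility costs a positive amount, for positively homogeneous utility. -/
theorem cost_pos_of_util_pos {m : ℕ} {u : (Fin m → ℝ) → ℝ} {p x : Fin m → ℝ}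
    (hu_hom : ∀ c : ℝ, 0 < c → ∀ x : Fin m → ℝ, (∀ j, 0 ≤ x j) → u (c • x) = c * u x)
    (hp : ∀ j, 0 < p j) (hx : ∀ j, 0 ≤ x j) (hux : 0 < u x) : 0 < ∑ j, p j * x j := by
  have hterm : ∀ j ∈ Finset.univ, 0 ≤ p j * x j := fun j _ => mul_nonneg (hp j).le (hx j)
  refine (Finset.sum_nonneg hterm).lt_of_ne fun h => ?_
  have hx0 : x = 0 := funext fun j =>
    (mul_eq_zero.1 ((Finset.sum_eq_zero_iff_of_nonneg hterm).1 h.symm j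
      (Finset.mem_univ j))).resolve_left (hp j).ne'
  have h2 := hu_hom 2 two_pos x hx
  rw [hx0, smul_zero] at h2
  rw [hx0] at hux
  linarith

/-- The buyer's part of the dual function, `b log u(x) - p·x`, has maximum
`b log v(p, b) - b`. -/
theorem isGreatest_log_util_sub_cost {m : ℕ} {u : (Fin m → ℝ) → ℝ} {p : Fin m → ℝ} {b : ℝ}
    (hu_cont : Continuous u)
    (hu_hom : ∀ c : ℝ, 0 < c → ∀ x : Fin m → ℝ, (∀ j, 0 ≤ x j) → u (c • x) = c * u x)
    (hu_pos : ∃ x : Fin m → ℝ, (∀ j, 0 ≤ x j) ∧ 0 < u x)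
    (hb : 0 < b) (hp : ∀ j, 0 < p j) :
    IsGreatest ((fun x => b * Real.log (u x) - ∑ j, p j * x j) ''
        {x : Fin m → ℝ | (∀ j, 0 ≤ x j) ∧ 0 < u x})
      (b * Real.log (indirectUtil u p b) - b) := by
  obtain ⟨x, ⟨hx, hxb⟩, hmax⟩ := (isCompact_budgetSet hp b).exists_isMaxOn
    ⟨0, by simp, by simpa using hb.le⟩ hu_cont.continuousOn
  have hv : indirectUtil u p b = u x := by
    refine IsGreatest.csSup_eq ⟨⟨x, hx, hxb, rfl⟩, ?_⟩
    rintro _ ⟨y, hy, hyb, rfl⟩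
    exact hmax ⟨hy, hyb⟩
  have hscale : ∀ y : Fin m → ℝ, (∀ j, 0 ≤ y j) → 0 < u y →
      b / (∑ j, p j * y j) * u y ≤ u x := by
    intro y hy huy
    have hc := cost_pos_of_util_pos hu_hom hp hy huy
    have hbc := div_pos hb hc
    rw [← hu_hom _ hbc y hy]
    refine hmax ⟨fun j => mul_nonneg hbc.le (hy j), ?_⟩
    rw [sum_mul_smul_apply, div_mul_cancel₀ _ hc.ne']
  have hux : 0 < u x := by
    obtain ⟨y, hy, huy⟩ := hu_pos
    exact (mul_pos (div_pos hb (cost_pos_of_util_pos hu_hom hp hy huy)) huy).trans_le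
      (hscale y hy huy)
  have hcost : ∑ j, p j * x j = b := by
    refine le_antisymm hxb ?_
    have h := (mul_le_iff_le_one_left hux).1 (hscale x hx hux)
    exact (div_le_one (cost_pos_of_util_pos hu_hom hp hx hux)).1 h
  rw [hv]
  refine ⟨⟨x, ⟨hx, hux⟩, by simp only [hcost]⟩, ?_⟩
  rintro _ ⟨y, ⟨hy, huy⟩, rfl⟩
  have hc := cost_pos_of_util_pos hu_hom hp hy huy
  have hbc := div_pos hb hc
  have hlog := Real.log_le_log (mul_pos hbc huy) (hscale y hy huy)
  rw [Real.log_mul hbc.ne' huy.ne'] at hlog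
  have hlow := Real.one_sub_inv_le_log_of_pos hbc
  rw [inv_div] at hlow
  have hmul := mul_le_mul_of_nonneg_left (show 1 - (∑ j, p j * y j) / b + Real.log (u y) ≤
    Real.log (u x) by linarith) hb.le
  rw [mul_add, mul_sub, mul_div_cancel₀ _ hb.ne'] at hmul
  dsimp only
  linarith

/-- The value of the Lagrangian dual function of the Eisenberg–Gale
program at a strictly positive price vector `p` equals
`Σ_j p_j + Σ_i (b_i log v_i(p, b_i) − b_i)`. -/
theorem eg_dual_function_value (n m : ℕ) (u : Fin n → (Fin m → ℝ) → ℝ)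
    (b : Fin n → ℝ) (p : Fin m → ℝ)
    (hu_cont : ∀ i, Continuous (u i))
    (hu_conc : ∀ i, ConcaveOn ℝ {x : Fin m → ℝ | ∀ j, 0 ≤ x j} (u i))
    (hu_hom : ∀ i, ∀ c : ℝ, 0 < c → ∀ x : Fin m → ℝ, (∀ j, 0 ≤ x j) →
        u i (c • x) = c * u i x)
    (hu_nonneg : ∀ i, ∀ x : Fin m → ℝ, (∀ j, 0 ≤ x j) → 0 ≤ u i x)
    (hu_pos : ∀ i, ∃ x : Fin m → ℝ, (∀ j, 0 ≤ x j) ∧ 0 < u i x)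
    (hb : ∀ i, 0 < b i) (hp : ∀ j, 0 < p j) :
    sSup {y : ℝ | ∃ X : Fin n → Fin m → ℝ,
        (∀ i, ∀ j, 0 ≤ X i j) ∧ (∀ i, 0 < u i (X i)) ∧
        y = (∑ i, b i * Real.log (u i (X i))) + ∑ j, p j * (1 - ∑ i, X i j)} =
    (∑ j, p j) + ∑ i, (b i * Real.log (indirectUtil (u i) p (b i)) - b i) := by
  have hbuyer := fun i =>
    isGreatest_log_util_sub_cost (hu_cont i) (hu_hom i) (hu_pos i) (hb i) hp
  have hsplit : ∀ X : Fin n → Fin m → ℝ,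
      (∑ i, b i * Real.log (u i (X i))) + ∑ j, p j * (1 - ∑ i, X i j) =
        (∑ j, p j) + ∑ i, (b i * Real.log (u i (X i)) - ∑ j, p j * X i j) := by
    intro X
    simp only [mul_sub, mul_one, Finset.sum_sub_distrib, Finset.mul_sum]
    rw [Finset.sum_comm (f := fun i j => p j * X i j)]
    ring
  refine IsGreatest.csSup_eq ⟨?_, ?_⟩
  · choose X hX hXval using fun i => (hbuyer i).1
    refine ⟨X, fun i => (hX i).1, fun i => (hX i).2, ?_⟩
    rw [hsplit]
    exact congrArg _ (Finset.sum_congr rfl fun i _ => (hXval i).symm)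
  · rintro _ ⟨X, hX, hXpos, rfl⟩
    rw [hsplit]
    refine add_le_add_right (Finset.sum_le_sum fun i _ => ?_) _
    exact (hbuyer i).2 ⟨X i, ⟨hX i, hXpos i⟩, rfl⟩
end

section
/- Consider n buyers with utility functions u_i : ℝ^m → ℝ, each continuous, concave on the nonnegative orthant, positively homogeneous of degree 1 there, representing locally non-satiated preferences, with { x ≥ 0 : u_i(x) ≥ 1 } nonempty, and budgets b_i > 0. Then for every p ∈ ℝ^m with strictly positive entries (so that each e_i(p,1) is finite and strictly positive and each v_i(p, b_i) is finite and strictly positive): Σ_{j=1}^m p_j − Σ_{i=1}^n b_i·log(e_i(p, 1)) = [ Σ_{j=1}^m p_j + Σ_{i=1}^n ( b_i·log(v_i(p, b_i)) − b_i ) ] − Σ_{i=1}^n ( b_i·log(b_i) − b_i ). In particular, the objective of the dual of the new convex program and the objective of the Eisenberg–Gale dual differ by the constant Σ_i ( b_i·log(b_i) − b_i ). -/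
/-- The expenditure function `e(p, ū) = inf { p·x : x ≥ 0, u(x) ≥ ū }`. -/
noncomputable def expend {m : ℕ} (u : (Fin m → ℝ) → ℝ) (p : Fin m → ℝ) (ubar : ℝ) : ℝ :=
  sInf {c : ℝ | ∃ x : Fin m → ℝ, (∀ j, 0 ≤ x j) ∧ ubar ≤ u x ∧ c = ∑ j, p j * x j}

theorem sum_price_mul_smul {m : ℕ} (p : Fin m → ℝ) (c : ℝ) (x : Fin m → ℝ) :
    ∑ j, p j * (c • x) j = c * ∑ j, p j * x j := by
  rw [Finset.mul_sum]
  exact Finset.sum_congr rfl fun j _ => by simp only [Pi.smul_apply, smul_eq_mul]; ring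

/-- For a continuous, positively homogeneous utility taking a value at least `1`, the indirect
utility is positive and `e(p, 1) = b / v(p, b)`. -/
theorem indirectUtil_pos_and_expend_one_eq {m : ℕ} {u : (Fin m → ℝ) → ℝ} {p : Fin m → ℝ} {b : ℝ}
    (hcont : Continuous u)
    (hhom : ∀ c : ℝ, 0 < c → ∀ x : Fin m → ℝ, (∀ j, 0 ≤ x j) → u (c • x) = c * u x)
    (hne : ∃ x : Fin m → ℝ, (∀ j, 0 ≤ x j) ∧ 1 ≤ u x)
    (hb : 0 < b) (hp : ∀ j, 0 < p j) :
    0 < indirectUtil u p b ∧ expend u p 1 = b / indirectUtil u p b := by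
  have hu0 : u 0 = 0 := by
    have h := hhom 2 two_pos 0 fun _ => le_rfl
    rw [smul_zero] at h
    linarith
  have hcost : ∀ x : Fin m → ℝ, (∀ j, 0 ≤ x j) → 1 ≤ u x → 0 < ∑ j, p j * x j := by
    intro x hx hux
    have hx0 : x ≠ 0 := by
      rintro rfl
      linarith
    obtain ⟨j, hj⟩ := Function.ne_iff.mp hx0
    exact Finset.sum_pos' (fun i _ => mul_nonneg (hp i).le (hx i))
      ⟨j, Finset.mem_univ j, mul_pos (hp j) (lt_of_le_of_ne (hx j) (Ne.symm hj))⟩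
  obtain ⟨z, ⟨hz, hzb⟩, hmax⟩ := (isCompact_budgetSet hp b).exists_isMaxOn
    ⟨0, fun _ => le_rfl, by simpa using hb.le⟩ hcont.continuousOn
  have hv : indirectUtil u p b = u z := by
    refine IsGreatest.csSup_eq ⟨⟨z, hz, hzb, rfl⟩, ?_⟩
    rintro _ ⟨x, hx, hxb, rfl⟩
    exact hmax ⟨hx, hxb⟩
  have hlower : ∀ x : Fin m → ℝ, (∀ j, 0 ≤ x j) → 1 ≤ u x → b ≤ u z * ∑ j, p j * x j := by
    intro x hx hux
    have hq := hcost x hx hux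
    have hc : 0 < b / ∑ j, p j * x j := div_pos hb hq
    have h : u ((b / ∑ j, p j * x j) • x) ≤ u z := hmax ⟨fun j => mul_nonneg hc.le (hx j), by
      rw [sum_price_mul_smul, div_mul_cancel₀ _ hq.ne']⟩
    rw [hhom _ hc x hx] at h
    exact (div_le_iff₀ hq).mp ((le_mul_of_one_le_right hc.le hux).trans h)
  have hpos : 0 < u z := by
    obtain ⟨x, hx, hux⟩ := hne
    exact pos_of_mul_pos_left (hb.trans_le (hlower x hx hux)) (hcost x hx hux).le
  rw [hv]
  refine ⟨hpos, IsLeast.csInf_eq ⟨?_, ?_⟩⟩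
  · have hw : ∀ j, 0 ≤ ((u z)⁻¹ • z) j := fun j => mul_nonneg (inv_pos.mpr hpos).le (hz j)
    have huw : 1 ≤ u ((u z)⁻¹ • z) := by
      rw [hhom _ (inv_pos.mpr hpos) z hz, inv_mul_cancel₀ hpos.ne']
    refine ⟨_, hw, huw, le_antisymm ?_ ?_⟩
    · rw [div_le_iff₀' hpos]
      exact hlower _ hw huw
    · rw [sum_price_mul_smul, div_eq_inv_mul]
      exact mul_le_mul_of_nonneg_left hzb (inv_pos.mpr hpos).le
  · rintro _ ⟨x, hx, hux, rfl⟩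
    rw [div_le_iff₀' hpos]
    exact hlower x hx hux

/-- For CCH utilities representing locally non-satiated preferences,
the objective of the dual of the new convex program and the Eisenberg–Gale dual
objective differ by the constant `Σ_i (b_i log b_i − b_i)`. -/
theorem dual_objectives_differ_by_constant (n m : ℕ) (u : Fin n → (Fin m → ℝ) → ℝ)
    (b : Fin n → ℝ) (p : Fin m → ℝ)
    (hu_cont : ∀ i, Continuous (u i))
    (hu_conc : ∀ i, ConcaveOn ℝ {x : Fin m → ℝ | ∀ j, 0 ≤ x j} (u i))
    (hu_hom : ∀ i, ∀ c : ℝ, 0 < c → ∀ x : Fin m → ℝ, (∀ j, 0 ≤ x j) →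
        u i (c • x) = c * u i x)
    (hu_lns : ∀ i, ∀ x : Fin m → ℝ, (∀ j, 0 ≤ x j) → ∀ ε : ℝ, 0 < ε →
        ∃ y : Fin m → ℝ, (∀ j, 0 ≤ y j) ∧ ‖y - x‖ < ε ∧ u i x < u i y)
    (hu_ne : ∀ i, ∃ x : Fin m → ℝ, (∀ j, 0 ≤ x j) ∧ 1 ≤ u i x)
    (hb : ∀ i, 0 < b i) (hp : ∀ j, 0 < p j) :
    (∑ j, p j) - ∑ i, b i * Real.log (expend (u i) p 1) =
    ((∑ j, p j) + ∑ i, (b i * Real.log (indirectUtil (u i) p (b i)) - b i))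
      - ∑ i, (b i * Real.log (b i) - b i) := by
  have hlog : ∀ i, b i * Real.log (expend (u i) p 1) =
      (b i * Real.log (b i) - b i) - (b i * Real.log (indirectUtil (u i) p (b i)) - b i) := by
    intro i
    obtain ⟨hv, he⟩ := indirectUtil_pos_and_expend_one_eq (hu_cont i) (hu_hom i) (hu_ne i) (hb i) hp
    rw [he, Real.log_div (hb i).ne' hv.ne']
    ring
  rw [Finset.sum_congr rfl fun i _ => hlog i, Finset.sum_sub_distrib]
  ring
end

section
/- Let u : ℝ^m → ℝ be continuous, concave on the nonnegative orthant, positively homogeneous of degree 1 there, nonnegative on the nonnegative orthant, representing locally non-satiated preferences, and suppose { x ≥ 0 : u(x) ≥ 1 } is nonempty. Let p ∈ ℝ^m have strictly positive entries. Then e(p, 1) · v(p, 1) = 1; equivalently, the derivative of the expenditure function with respect to the utility level times the derivative of the indirect utility function with respect to the budget equals 1. -/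
/-- A nonnegative bundle with nonzero utility costs a positive amount when the utility function is
positively homogeneous. -/
theorem cost_pos_of_utility_ne_zero {m : ℕ} {u : (Fin m → ℝ) → ℝ}
    (hu_hom : ∀ c : ℝ, 0 < c → ∀ x : Fin m → ℝ, (∀ j, 0 ≤ x j) → u (c • x) = c * u x)
    {p x : Fin m → ℝ} (hp : ∀ j, 0 < p j) (hx : ∀ j, 0 ≤ x j) (hux : u x ≠ 0) :
    0 < ∑ j, p j * x j := by
  have hterm : ∀ j ∈ Finset.univ, 0 ≤ p j * x j := fun j _ => mul_nonneg (hp j).le (hx j)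
  refine (Finset.sum_nonneg hterm).lt_of_ne fun h => hux ?_
  have hx0 : x = 0 := by
    ext j
    have := (Finset.sum_eq_zero_iff_of_nonneg hterm).1 h.symm j (Finset.mem_univ j)
    exact (mul_eq_zero.1 this).resolve_left (hp j).ne'
  have h2 := hu_hom 2 two_pos x hx
  rw [hx0, smul_zero] at h2
  rw [hx0]
  linarith

theorem sum_mul_smul {m : ℕ} (c : ℝ) (p x : Fin m → ℝ) :
    ∑ j, p j * (c • x) j = c * ∑ j, p j * x j := by
  simp only [Finset.mul_sum, Pi.smul_apply, smul_eq_mul, mul_left_comm]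

/-- For a CCH, nonnegative, locally non-satiated utility function with
`{x ≥ 0 : u(x) ≥ 1}` nonempty and strictly positive prices, the "buck-per-bang"
`e(p, 1)` and the "bang-per-buck" `v(p, 1)` are reciprocal: `e(p,1) · v(p,1) = 1`. -/
theorem expend_mul_indirectUtil_eq_one (m : ℕ) (u : (Fin m → ℝ) → ℝ)
    (hu_cont : Continuous u)
    (hu_conc : ConcaveOn ℝ {x : Fin m → ℝ | ∀ j, 0 ≤ x j} u)
    (hu_hom : ∀ c : ℝ, 0 < c → ∀ x : Fin m → ℝ, (∀ j, 0 ≤ x j) → u (c • x) = c * u x)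
    (hu_nonneg : ∀ x : Fin m → ℝ, (∀ j, 0 ≤ x j) → 0 ≤ u x)
    (hu_lns : ∀ x : Fin m → ℝ, (∀ j, 0 ≤ x j) → ∀ ε : ℝ, 0 < ε →
        ∃ y : Fin m → ℝ, (∀ j, 0 ≤ y j) ∧ ‖y - x‖ < ε ∧ u x < u y)
    (hu_ne : ∃ x : Fin m → ℝ, (∀ j, 0 ≤ x j) ∧ 1 ≤ u x)
    (p : Fin m → ℝ) (hp : ∀ j, 0 < p j) :
    expend u p 1 * indirectUtil u p 1 = 1 := by
  have hsmul : ∀ {c : ℝ} {x : Fin m → ℝ}, 0 < c → (∀ j, 0 ≤ x j) → ∀ j, 0 ≤ (c • x) j :=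
    fun hc hx j => mul_nonneg hc.le (hx j)
  obtain ⟨z, ⟨hz, hzb⟩, hmax⟩ := (isCompact_budgetSet hp 1).exists_isMaxOn
    ⟨0, by simp⟩ hu_cont.continuousOn
  have hle : ∀ x : Fin m → ℝ, (∀ j, 0 ≤ x j) → 1 ≤ u x → 1 ≤ u z * ∑ j, p j * x j := by
    intro x hx hux
    have hc := cost_pos_of_utility_ne_zero hu_hom hp hx (by linarith)
    have hmem := hmax (a := (∑ j, p j * x j)⁻¹ • x)
      ⟨hsmul (inv_pos.2 hc) hx, by rw [sum_mul_smul, inv_mul_cancel₀ hc.ne']⟩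
    rw [Set.mem_ofPred_eq, hu_hom _ (inv_pos.2 hc) x hx, inv_mul_le_iff₀' hc] at hmem
    exact hux.trans hmem
  have hpos : 0 < u z := by
    obtain ⟨x, hx, hux⟩ := hu_ne
    refine (hu_nonneg z hz).lt_of_ne fun h => ?_
    have := hle x hx hux
    rw [← h] at this
    linarith
  have hv : indirectUtil u p 1 = u z := by
    refine IsGreatest.csSup_eq ⟨⟨z, hz, hzb, rfl⟩, ?_⟩
    rintro _ ⟨x, hx, hxb, rfl⟩
    exact hmax ⟨hx, hxb⟩
  have hw := hsmul (inv_pos.2 hpos) hz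
  have huw : u ((u z)⁻¹ • z) = 1 := by
    rw [hu_hom _ (inv_pos.2 hpos) z hz, inv_mul_cancel₀ hpos.ne']
  have he : expend u p 1 = (u z)⁻¹ := by
    have hlower : ∀ x : Fin m → ℝ, (∀ j, 0 ≤ x j) → 1 ≤ u x → (u z)⁻¹ ≤ ∑ j, p j * x j :=
      fun x hx hux => (inv_le_iff_one_le_mul₀' hpos).2 (hle x hx hux)
    refine IsLeast.csInf_eq ⟨⟨(u z)⁻¹ • z, hw, huw.ge, ?_⟩, ?_⟩
    · refine le_antisymm (hlower _ hw huw.ge) ?_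
      rw [sum_mul_smul]
      exact mul_le_of_le_one_right (inv_pos.2 hpos).le hzb
    · rintro _ ⟨x, hx, hux, rfl⟩
      exact hlower x hx hux
  rw [he, hv, inv_mul_cancel₀ hpos.ne']
end

section
/- (Shephard's lemma, generalized for set-valued Hicksian demand.) Let X ⊆ ℝ^m be a nonempty, compact, convex set of nonnegative bundles, let u : ℝ^m → ℝ be continuous and concave on X, and let ū be such that S = { x ∈ X : u(x) ≥ ū } is nonempty. Define e(p) = min_{x ∈ S} p·x and H(p) = { x ∈ S : p·x = e(p) }. Then for every p̂ ∈ ℝ^m, the set of supergradients of the concave function e at p̂, namely { g ∈ ℝ^m : e(q) ≤ e(p̂) + g·(q − p̂) for all q ∈ ℝ^m }, is equal to H(p̂). -/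
/-- On a nonempty compact set, the infimum of the
linear functional `x ↦ ∑ j, p j * x j` is a least element of its set of values. -/
theorem IsCompact.isLeast_sInf_sum_mul {ι : Type*} [Fintype ι] {S : Set (ι → ℝ)}
    (hS : IsCompact S) (hne : S.Nonempty) (p : ι → ℝ) :
    IsLeast {c : ℝ | ∃ x, x ∈ S ∧ c = ∑ j, p j * x j}
      (sInf {c : ℝ | ∃ x, x ∈ S ∧ c = ∑ j, p j * x j}) := by
  have himage : {c : ℝ | ∃ x, x ∈ S ∧ c = ∑ j, p j * x j} = (fun x => ∑ j, p j * x j) '' S := by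
    ext c
    simp [eq_comm]
  rw [himage]
  exact (hS.image (by fun_prop)).isLeast_sInf (hne.image _)

/-- A point whose pairing with every functional is at least the minimum of that functional over a
closed convex set belongs to the set. -/
theorem Convex.mem_of_forall_exists_sum_mul_le {ι : Type*} [Fintype ι] {S : Set (ι → ℝ)}
    (hS : Convex ℝ S) (hclosed : IsClosed S) {g : ι → ℝ}
    (hg : ∀ p : ι → ℝ, ∃ x ∈ S, ∑ j, p j * x j ≤ ∑ j, p j * g j) : g ∈ S := by
  classical
  by_contra hmem
  obtain ⟨f, c, hfg, hfS⟩ := geometric_hahn_banach_point_closed hS hclosed hmem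
  have hf (x : ι → ℝ) : f x = ∑ j, f (Pi.single j 1) * x j := by
    conv_lhs => rw [pi_eq_sum_univ' x, map_sum]
    refine Finset.sum_congr rfl fun j _ => ?_
    rw [map_smul, smul_eq_mul, mul_comm]
  obtain ⟨x, hx, hle⟩ := hg fun j => f (Pi.single j 1)
  rw [← hf, ← hf] at hle
  linarith [hfS x hx]

/-- Shephard's lemma, generalized for set-valued Hicksian demand:
For a nonempty compact convex set `X` of nonnegative bundles, a utility `u`
continuous and concave on `X`, and a utility level `ubar` with
`S = {x ∈ X : u x ≥ ubar}` nonempty, the superdifferential of the concave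
expenditure function `e(p) = min_{x ∈ S} p·x` at any `phat` equals the Hicksian
demand `H(phat) = {x ∈ S : phat·x = e(phat)}`. -/
theorem shephard_generalized (m : ℕ) (X : Set (Fin m → ℝ)) (u : (Fin m → ℝ) → ℝ)
    (ubar : ℝ)
    (hX_ne : X.Nonempty) (hX_cpt : IsCompact X) (hX_cvx : Convex ℝ X)
    (hX_nonneg : ∀ x ∈ X, ∀ j, 0 ≤ x j)
    (hu_cont : ContinuousOn u X) (hu_conc : ConcaveOn ℝ X u)
    (hS_ne : {x | x ∈ X ∧ ubar ≤ u x}.Nonempty)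
    (e : (Fin m → ℝ) → ℝ)
    (he : ∀ p : Fin m → ℝ,
        e p = sInf {c : ℝ | ∃ x, (x ∈ X ∧ ubar ≤ u x) ∧ c = ∑ j, p j * x j})
    (phat : Fin m → ℝ) :
    {g : Fin m → ℝ | ∀ q : Fin m → ℝ, e q ≤ e phat + ∑ j, g j * (q j - phat j)} =
    {x : Fin m → ℝ | (x ∈ X ∧ ubar ≤ u x) ∧ (∑ j, phat j * x j) = e phat} := by
  have hS_cvx : Convex ℝ {x | x ∈ X ∧ ubar ≤ u x} := hu_conc.convex_ge ubar
  have hS_closed : IsClosed {x | x ∈ X ∧ ubar ≤ u x} :=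
    hu_cont.preimage_isClosed_of_isClosed hX_cpt.isClosed isClosed_Ici
  have hS_cpt : IsCompact {x | x ∈ X ∧ ubar ≤ u x} :=
    hX_cpt.of_isClosed_subset hS_closed fun _ hx => hx.1
  have hleast (p : Fin m → ℝ) :
      IsLeast {c : ℝ | ∃ x, (x ∈ X ∧ ubar ≤ u x) ∧ c = ∑ j, p j * x j} (e p) := by
    rw [he p]
    exact hS_cpt.isLeast_sInf_sum_mul hS_ne p
  have he_le (p x : Fin m → ℝ) (hx : x ∈ X ∧ ubar ≤ u x) : e p ≤ ∑ j, p j * x j :=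
    (hleast p).2 ⟨x, hx, rfl⟩
  ext g
  constructor
  · intro hg
    have hg_mem : g ∈ X ∧ ubar ≤ u g := by
      refine hS_cvx.mem_of_forall_exists_sum_mul_le hS_closed fun p => ?_
      obtain ⟨x, hx, hex⟩ := (hleast (phat + p)).1
      refine ⟨x, hx, ?_⟩
      have hsuper := hg (phat + p)
      simp only [hex, Pi.add_apply, add_mul, Finset.sum_add_distrib, add_sub_cancel_left]
        at hsuper
      simp only [mul_comm (g _)] at hsuper
      linarith [he_le phat x hx]
    refine ⟨hg_mem, le_antisymm ?_ (he_le phat g hg_mem)⟩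
    obtain ⟨x, -, hex⟩ := (hleast 0).1
    have hzero := hg 0
    simp only [hex, Pi.zero_apply, zero_mul, Finset.sum_const_zero, zero_sub, neg_mul,
      Finset.sum_neg_distrib, mul_comm (g _)] at hzero
    linarith
  · rintro ⟨hg_mem, hg_eq⟩ q
    have hq := he_le q g hg_mem
    simp only [sub_mul, Finset.sum_sub_distrib, mul_comm (g _)]
    linarith
end

section
/- Let u : ℝ^m → ℝ be continuous, concave on the nonnegative orthant, positively homogeneous of degree 1 there, nonnegative on the nonnegative orthant, representing locally non-satiated preferences, with { x ≥ 0 : u(x) ≥ 1 } nonempty and with e(q, 1) finite and strictly positive for every q with strictly positive entries. Fix a budget b > 0 and a price vector p̂ with strictly positive entries. Then the set of supergradients at p̂ of the concave function q ↦ b·log(e(q, 1)) defined on the set of price vectors with strictly positive entries, namely { g ∈ ℝ^m : b·log(e(q,1)) ≤ b·log(e(p̂,1)) + g·(q − p̂) for all q with strictly positive entries }, is equal to the Marshallian demand M(p̂, b). -/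
/-- The Marshallian demand `M(p, b) = { x ≥ 0 : p·x ≤ b, u(x) = v(p, b) }`. -/
noncomputable def marshallian {m : ℕ} (u : (Fin m → ℝ) → ℝ) (p : Fin m → ℝ) (b : ℝ) :
    Set (Fin m → ℝ) :=
  {x | (∀ j, 0 ≤ x j) ∧ (∑ j, p j * x j) ≤ b ∧ u x = indirectUtil u p b}

open Matrix

section Expenditure

variable {m : ℕ} {u : (Fin m → ℝ) → ℝ} {p q x g : Fin m → ℝ} {b : ℝ}

theorem expend_one_le_dotProduct (hq : 0 ≤ q) (hx : 0 ≤ x) (hux : 1 ≤ u x) :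
    expend u q 1 ≤ q ⬝ᵥ x := by
  refine csInf_le ⟨0, ?_⟩ ⟨x, hx, hux, rfl⟩
  rintro c ⟨y, hy, -, rfl⟩
  exact dotProduct_nonneg_of_nonneg hq hy

theorem le_expend_one (hne : ∃ x : Fin m → ℝ, 0 ≤ x ∧ 1 ≤ u x) {c : ℝ}
    (h : ∀ x : Fin m → ℝ, 0 ≤ x → 1 ≤ u x → c ≤ q ⬝ᵥ x) : c ≤ expend u q 1 := by
  obtain ⟨x, hx, hux⟩ := hne
  refine le_csInf ⟨_, x, hx, hux, rfl⟩ ?_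
  rintro c ⟨y, hy, huy, rfl⟩
  exact h y hy huy

theorem mul_expend_one_le_expend_smul (hne : ∃ x : Fin m → ℝ, 0 ≤ x ∧ 1 ≤ u x)
    (hq : 0 ≤ q) {t : ℝ} (ht : 0 ≤ t) : t * expend u q 1 ≤ expend u (t • q) 1 := by
  refine le_expend_one hne fun x hx hux => ?_
  rw [smul_dotProduct, smul_eq_mul]
  exact mul_le_mul_of_nonneg_left (expend_one_le_dotProduct hq hx hux) ht

theorem expend_one_mono (hne : ∃ x : Fin m → ℝ, 0 ≤ x ∧ 1 ≤ u x)
    (hp : 0 ≤ p) (hpq : p ≤ q) : expend u p 1 ≤ expend u q 1 :=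
  le_expend_one hne fun _ hx hux => (expend_one_le_dotProduct hp hx hux).trans
    (dotProduct_le_dotProduct_of_nonneg_right hpq hx)

theorem expend_one_mul_le_dotProduct
    (hom : ∀ c : ℝ, 0 < c → ∀ x : Fin m → ℝ, 0 ≤ x → u (c • x) = c * u x)
    (hnonneg : ∀ x : Fin m → ℝ, 0 ≤ x → 0 ≤ u x) (hq : 0 ≤ q) (hx : 0 ≤ x) :
    expend u q 1 * u x ≤ q ⬝ᵥ x := by
  rcases (hnonneg x hx).eq_or_lt with h | h
  · rw [← h, mul_zero]
    exact dotProduct_nonneg_of_nonneg hq hx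
  · have hinv := inv_pos.2 h
    have key : expend u q 1 ≤ q ⬝ᵥ ((u x)⁻¹ • x) :=
      expend_one_le_dotProduct hq (smul_nonneg hinv.le hx)
        (by rw [hom _ hinv x hx, inv_mul_cancel₀ h.ne'])
    rw [dotProduct_smul, smul_eq_mul, ← div_eq_inv_mul] at key
    exact (le_div_iff₀ h).1 key

theorem indirectUtil_eq_div_expend_one
    (hom : ∀ c : ℝ, 0 < c → ∀ x : Fin m → ℝ, 0 ≤ x → u (c • x) = c * u x)
    (hnonneg : ∀ x : Fin m → ℝ, 0 ≤ x → 0 ≤ u x)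
    (hne : ∃ x : Fin m → ℝ, 0 ≤ x ∧ 1 ≤ u x)
    (hb : 0 < b) (hp : 0 ≤ p) (he : 0 < expend u p 1) :
    indirectUtil u p b = b / expend u p 1 := by
  have hub : ∀ c ∈ {c : ℝ | ∃ x : Fin m → ℝ, (∀ j, 0 ≤ x j) ∧ (∑ j, p j * x j) ≤ b ∧ c = u x},
      c ≤ b / expend u p 1 := by
    rintro c ⟨x, hx, hxb, rfl⟩
    rw [le_div_iff₀' he]
    exact (expend_one_mul_le_dotProduct hom hnonneg hp hx).trans hxb
  have hle : ∀ x : Fin m → ℝ, 0 ≤ x → p ⬝ᵥ x ≤ b → u x ≤ indirectUtil u p b :=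
    fun x hx hxb => le_csSup ⟨_, hub⟩ ⟨x, hx, hxb, rfl⟩
  refine le_antisymm (csSup_le ⟨u 0, 0, fun _ => le_rfl, by simpa using hb.le, rfl⟩ hub) ?_
  have hv : ∀ x : Fin m → ℝ, 0 ≤ x → 1 ≤ u x → b ≤ indirectUtil u p b * (p ⬝ᵥ x) := by
    intro x hx hux
    have hpx : 0 < p ⬝ᵥ x := he.trans_le (expend_one_le_dotProduct hp hx hux)
    have ht : 0 < b / (p ⬝ᵥ x) := div_pos hb hpx
    have h := hle ((b / (p ⬝ᵥ x)) • x) (smul_nonneg ht.le hx)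
      (by rw [dotProduct_smul, smul_eq_mul, div_mul_cancel₀ _ hpx.ne'])
    rw [hom _ ht x hx] at h
    rw [← div_le_iff₀ hpx]
    exact (le_mul_of_one_le_right ht.le hux).trans h
  have hpos : 0 < indirectUtil u p b := by
    obtain ⟨x, hx, hux⟩ := hne
    have hpx : 0 < p ⬝ᵥ x := he.trans_le (expend_one_le_dotProduct hp hx hux)
    exact pos_of_mul_pos_left (hb.trans_le (hv x hx hux)) hpx.le
  rw [div_le_iff₀ he, ← div_le_iff₀' hpos]
  exact le_expend_one hne fun x hx hux => (div_le_iff₀' hpos).2 (hv x hx hux)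

/-- A nonnegative, concave and positively homogeneous function is monotone on the orthant. -/
theorem ConcaveOn.le_add_of_homogeneous
    (hconc : ConcaveOn ℝ {x : Fin m → ℝ | ∀ j, 0 ≤ x j} u)
    (hom : ∀ c : ℝ, 0 < c → ∀ x : Fin m → ℝ, 0 ≤ x → u (c • x) = c * u x)
    (hnonneg : ∀ x : Fin m → ℝ, 0 ≤ x → 0 ≤ u x) {y : Fin m → ℝ} (hx : 0 ≤ x) (hy : 0 ≤ y) :
    u x ≤ u (x + y) := by
  have h : (1 / 2 : ℝ) • u x + (1 / 2 : ℝ) • u y ≤ u ((1 / 2 : ℝ) • x + (1 / 2 : ℝ) • y) :=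
    hconc.2 hx hy (by norm_num) (by norm_num) (by norm_num)
  rw [← smul_add, ← smul_add, hom _ (by norm_num) _ (add_nonneg hx hy), smul_eq_mul] at h
  linarith [hnonneg y hy]

/-- A point outside a superlevel set of `u` is separated from it by nonnegative prices. -/
theorem exists_nonneg_separating_prices (hcont : Continuous u)
    (hconc : ConcaveOn ℝ {x : Fin m → ℝ | ∀ j, 0 ≤ x j} u)
    (hom : ∀ c : ℝ, 0 < c → ∀ x : Fin m → ℝ, 0 ≤ x → u (c • x) = c * u x)
    (hnonneg : ∀ x : Fin m → ℝ, 0 ≤ x → 0 ≤ u x) {l : ℝ}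
    (hne : ∃ x : Fin m → ℝ, 0 ≤ x ∧ l ≤ u x) (hg : u g < l) :
    ∃ q : Fin m → ℝ, 0 ≤ q ∧ ∃ s, q ⬝ᵥ g < s ∧
      ∀ x : Fin m → ℝ, 0 ≤ x → l ≤ u x → s < q ⬝ᵥ x := by
  have hclosed : IsClosed {x ∈ {x : Fin m → ℝ | ∀ j, 0 ≤ x j} | l ≤ u x} :=
    (isClosed_Ici (a := (0 : Fin m → ℝ))).inter (isClosed_le continuous_const hcont)
  obtain ⟨f, s, hfg, hfs⟩ :=
    geometric_hahn_banach_point_closed (hconc.convex_ge l) hclosed (x := g)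
      fun h => hg.not_ge h.2
  have hf : ∀ x, f x = (fun j => f (Pi.single j 1)) ⬝ᵥ x := by
    intro x
    conv_lhs => rw [← Finset.univ_sum_single x, map_sum]
    refine Finset.sum_congr rfl fun j _ => ?_
    rw [show (Pi.single j (x j) : Fin m → ℝ) = x j • Pi.single j 1 by
      rw [← Pi.single_smul, smul_eq_mul, mul_one], map_smul, smul_eq_mul, mul_comm]
  refine ⟨fun j => f (Pi.single j 1), fun j => ?_, s, hf g ▸ hfg,
    fun x hx hux => hf x ▸ hfs x ⟨hx, hux⟩⟩
  obtain ⟨x, hx, hux⟩ := hne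
  by_contra! hneg
  replace hneg : f (Pi.single j 1) < 0 := hneg
  have hsx := hfs x ⟨hx, hux⟩
  set t := (f x - s) / (-f (Pi.single j 1)) with ht
  have ht0 : 0 ≤ t := div_nonneg (by linarith) (by linarith)
  have hadd : 0 ≤ t • (Pi.single j 1 : Fin m → ℝ) :=
    smul_nonneg ht0 (Pi.single_nonneg.2 zero_le_one)
  have h := hfs (x + t • Pi.single j 1)
    ⟨add_nonneg hx hadd, hux.trans (hconc.le_add_of_homogeneous hom hnonneg hx hadd)⟩
  rw [map_add, map_smul, smul_eq_mul] at h
  have : t * (-f (Pi.single j 1)) = f x - s := div_mul_cancel₀ _ (by linarith)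
  linarith

theorem eq_of_forall_mul_log_le {B : ℝ} (hb : 0 < b)
    (h : ∀ t : ℝ, 0 < t → b * Real.log t ≤ (t - 1) * B) : B = b := by
  have hB : 0 < B := by
    have h2 := h 2 two_pos
    have := mul_pos hb (Real.log_pos one_lt_two)
    linarith
  by_contra hne
  have hlt := Real.log_lt_sub_one_of_pos (div_pos hB hb)
    (fun h1 => hne ((div_eq_one_iff_eq hb.ne').1 h1))
  have h1 := h (b / B) (div_pos hb hB)
  rw [← inv_div, Real.log_inv, sub_mul, inv_div, div_mul_cancel₀ _ hB.ne', one_mul] at h1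
  have h2 := mul_lt_mul_of_pos_left hlt hb
  rw [mul_sub, mul_div_cancel₀ _ hb.ne', mul_one] at h2
  linarith

theorem log_expend_le_of_mem_marshallian
    (hom : ∀ c : ℝ, 0 < c → ∀ x : Fin m → ℝ, 0 ≤ x → u (c • x) = c * u x)
    (hnonneg : ∀ x : Fin m → ℝ, 0 ≤ x → 0 ≤ u x)
    (hne : ∃ x : Fin m → ℝ, 0 ≤ x ∧ 1 ≤ u x)
    (hb : 0 < b) (hp : 0 ≤ p) (hep : 0 < expend u p 1) (hq : 0 ≤ q) (heq : 0 < expend u q 1)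
    (hg : g ∈ marshallian u p b) :
    b * Real.log (expend u q 1) ≤ b * Real.log (expend u p 1) + g ⬝ᵥ (q - p) := by
  obtain ⟨hg0, hgb, hug⟩ := hg
  rw [indirectUtil_eq_div_expend_one hom hnonneg hne hb hp hep] at hug
  have h := expend_one_mul_le_dotProduct hom hnonneg hq hg0
  have hpb : p ⬝ᵥ g ≤ b := hgb
  rw [hug, mul_div_left_comm] at h
  have hratio : 0 < expend u q 1 / expend u p 1 := div_pos heq hep
  have hlog := mul_le_mul_of_nonneg_left (Real.log_le_sub_one_of_pos hratio) hb.le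
  rw [Real.log_div heq.ne' hep.ne'] at hlog
  rw [dotProduct_sub, dotProduct_comm g q, dotProduct_comm g p]
  linarith

theorem mem_marshallian_of_log_expend_le (hcont : Continuous u)
    (hconc : ConcaveOn ℝ {x : Fin m → ℝ | ∀ j, 0 ≤ x j} u)
    (hom : ∀ c : ℝ, 0 < c → ∀ x : Fin m → ℝ, 0 ≤ x → u (c • x) = c * u x)
    (hnonneg : ∀ x : Fin m → ℝ, 0 ≤ x → 0 ≤ u x)
    (hne : ∃ x : Fin m → ℝ, 0 ≤ x ∧ 1 ≤ u x)
    (he : ∀ q : Fin m → ℝ, (∀ j, 0 < q j) → 0 < expend u q 1)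
    (hb : 0 < b) (hp : ∀ j, 0 < p j)
    (hg : ∀ q : Fin m → ℝ, (∀ j, 0 < q j) →
      b * Real.log (expend u q 1) ≤ b * Real.log (expend u p 1) + g ⬝ᵥ (q - p)) :
    g ∈ marshallian u p b := by
  have hp0 : 0 ≤ p := fun j => (hp j).le
  have hscale : ∀ q : Fin m → ℝ, (∀ j, 0 < q j) → ∀ t : ℝ, 0 < t →
      b * Real.log t + b * Real.log (expend u q 1) ≤
        b * Real.log (expend u p 1) + (t * (q ⬝ᵥ g) - p ⬝ᵥ g) := by
    intro q hq t ht
    have h := hg (t • q) fun j => mul_pos ht (hq j)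
    rw [dotProduct_sub, dotProduct_smul, smul_eq_mul, dotProduct_comm g q,
      dotProduct_comm g p] at h
    refine le_trans ?_ h
    rw [← mul_add, ← Real.log_mul ht.ne' (he q hq).ne']
    exact mul_le_mul_of_nonneg_left (Real.log_le_log (mul_pos ht (he q hq))
      (mul_expend_one_le_expend_smul hne (fun j => (hq j).le) ht.le)) hb.le
  have hpg : p ⬝ᵥ g = b :=
    eq_of_forall_mul_log_le hb fun t ht => by linarith [hscale p hp t ht]
  have hg0 : 0 ≤ g := by
    intro j
    have hs : (0 : Fin m → ℝ) ≤ Pi.single j 1 := Pi.single_nonneg.2 zero_le_one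
    have h := hg (p + Pi.single j 1) fun i => add_pos_of_pos_of_nonneg (hp i) (hs i)
    rw [add_sub_cancel_left, dotProduct_single, mul_one] at h
    have hmono := mul_le_mul_of_nonneg_left (Real.log_le_log (he p hp)
      (expend_one_mono hne hp0 (le_add_of_nonneg_right hs))) hb.le
    simp only [Pi.zero_apply]
    linarith
  refine ⟨hg0, hpg.le, ?_⟩
  rw [indirectUtil_eq_div_expend_one hom hnonneg hne hb hp0 (he p hp)]
  refine le_antisymm ?_ ?_
  · rw [le_div_iff₀' (he p hp), ← hpg]
    exact expend_one_mul_le_dotProduct hom hnonneg hp0 hg0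
  · by_contra! hlt
    set l := b / expend u p 1 with hl
    have hl0 : 0 < l := div_pos hb (he p hp)
    have hscaled : ∀ x : Fin m → ℝ, 0 ≤ x → 1 ≤ u x → 0 ≤ l • x ∧ l ≤ u (l • x) :=
      fun x hx hux => ⟨smul_nonneg hl0.le hx, by
        rw [hom l hl0 x hx]; exact le_mul_of_one_le_right hl0.le hux⟩
    obtain ⟨q, hq, s, hqg, hqs⟩ :=
      exists_nonneg_separating_prices hcont hconc hom hnonneg
        (hne.imp' (l • ·) fun x hx => hscaled x hx.1 hx.2) hlt
    set δ := (s - q ⬝ᵥ g) / (2 * b) with hδ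
    have hδ0 : 0 < δ := div_pos (by linarith) (by linarith)
    have hδb : δ * b = (s - q ⬝ᵥ g) / 2 := by rw [hδ]; field_simp
    have hr : ∀ j, 0 < (q + δ • p) j :=
      fun j => add_pos_of_nonneg_of_pos (hq j) (mul_pos hδ0 (hp j))
    have hrg : (q + δ • p) ⬝ᵥ g < s := by
      rw [add_dotProduct, smul_dotProduct, smul_eq_mul, hpg, hδb]
      linarith
    have hrg0 : 0 < (q + δ • p) ⬝ᵥ g := by
      rw [add_dotProduct, smul_dotProduct, smul_eq_mul, hpg]
      exact add_pos_of_nonneg_of_pos (dotProduct_nonneg_of_nonneg hq hg0) (mul_pos hδ0 hb)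
    have hsr : s / l ≤ expend u (q + δ • p) 1 := by
      refine le_expend_one hne fun x hx hux => ?_
      have h := hqs _ (hscaled x hx hux).1 (hscaled x hx hux).2
      rw [dotProduct_smul, smul_eq_mul] at h
      rw [add_dotProduct, smul_dotProduct, smul_eq_mul]
      have hpx := mul_nonneg hδ0.le (dotProduct_nonneg_of_nonneg hp0 hx)
      linarith [(div_le_iff₀' hl0).2 h.le]
    set r := q + δ • p
    have h := hscale r hr (b / (r ⬝ᵥ g)) (div_pos hb hrg0)
    rw [div_mul_cancel₀ _ hrg0.ne', hpg, sub_self, add_zero, ← mul_add,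
      ← Real.log_mul (div_pos hb hrg0).ne' (he r hr).ne'] at h
    have h' := (Real.log_le_log_iff (mul_pos (div_pos hb hrg0) (he r hr)) (he p hp)).1
      (le_of_mul_le_mul_left h hb)
    rw [div_mul_eq_mul_div, div_le_iff₀ hrg0] at h'
    rw [hl, div_div_eq_mul_div, div_le_iff₀ hb] at hsr
    have := mul_lt_mul_of_pos_right hrg (he p hp)
    linarith

end Expenditure

/-- The set of supergradients at `phat` of the concave function
`q ↦ b·log(e(q, 1))` on the set of strictly positive price vectors equals the
Marshallian demand `M(phat, b)`. -/
theorem supergradients_log_expend_eq_marshallian (m : ℕ) (u : (Fin m → ℝ) → ℝ)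
    (b : ℝ) (phat : Fin m → ℝ)
    (hu_cont : Continuous u)
    (hu_conc : ConcaveOn ℝ {x : Fin m → ℝ | ∀ j, 0 ≤ x j} u)
    (hu_hom : ∀ c : ℝ, 0 < c → ∀ x : Fin m → ℝ, (∀ j, 0 ≤ x j) → u (c • x) = c * u x)
    (hu_nonneg : ∀ x : Fin m → ℝ, (∀ j, 0 ≤ x j) → 0 ≤ u x)
    (hu_lns : ∀ x : Fin m → ℝ, (∀ j, 0 ≤ x j) → ∀ ε : ℝ, 0 < ε →
        ∃ y : Fin m → ℝ, (∀ j, 0 ≤ y j) ∧ ‖y - x‖ < ε ∧ u x < u y)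
    (hu_ne : ∃ x : Fin m → ℝ, (∀ j, 0 ≤ x j) ∧ 1 ≤ u x)
    (he_pos : ∀ q : Fin m → ℝ, (∀ j, 0 < q j) → 0 < expend u q 1)
    (hb : 0 < b) (hphat : ∀ j, 0 < phat j) :
    {g : Fin m → ℝ | ∀ q : Fin m → ℝ, (∀ j, 0 < q j) →
        b * Real.log (expend u q 1) ≤
          b * Real.log (expend u phat 1) + ∑ j, g j * (q j - phat j)} =
    marshallian u phat b := by
  ext g
  refine ⟨fun hg => mem_marshallian_of_log_expend_le hu_cont hu_conc hu_hom hu_nonneg hu_ne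
    he_pos hb hphat hg, fun hg q hq => ?_⟩
  exact log_expend_le_of_mem_marshallian hu_hom hu_nonneg hu_ne hb (fun j => (hphat j).le)
    (he_pos phat hphat) (fun j => (hq j).le) (he_pos q hq) hg
end

section
/- Let V ⊆ ℝ^n be a nonempty convex set, let f : ℝ^n → ℝ be convex, and let h : ℝ^n → ℝ be convex and differentiable; define the Bregman divergence D_h(x, y) = h(x) − h(y) − ∇h(y)·(x − y). Fix γ > 0 and a sequence x(0), x(1), x(2), … in V such that for each t there is a subgradient g(t) of f at x(t) with x(t+1) ∈ argmin_{x ∈ V} [ g(t)·(x − x(t)) + γ·D_h(x, x(t)) ], and suppose that for every t, f(x(t+1)) ≤ f(x(t)) + g(t)·(x(t+1) − x(t)) + γ·D_h(x(t+1), x(t)). If x* minimizes f over V, then for every t ≥ 1, f(x(t)) − f(x*) ≤ (γ / t)·D_h(x*, x(0)). -/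
open scoped RealInnerProductSpace

section Bregman

variable {E : Type*} [NormedAddCommGroup E] [InnerProductSpace ℝ E] [CompleteSpace E]

/-- The gradient inequality: a convex function lies above its tangent planes. -/
theorem ConvexOn.add_inner_gradient_le {h : E → ℝ} (hh : ConvexOn ℝ Set.univ h) {y v : E}
    (hv : HasGradientAt h v y) (x : E) : h y + ⟪v, x - y⟫ ≤ h x := by
  have hline : ConvexOn ℝ Set.univ (h ∘ AffineMap.lineMap (k := ℝ) y x) :=
    hh.comp_affineMap (AffineMap.lineMap y x)
  have hderiv : HasDerivAt (h ∘ AffineMap.lineMap (k := ℝ) y x) ⟪v, x - y⟫ 0 := by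
    have hF : HasFDerivAt h (InnerProductSpace.toDual ℝ E v)
        (AffineMap.lineMap (k := ℝ) y x 0) := by
      simpa using hv.hasFDerivAt
    simpa using hF.comp_hasDerivAt (0 : ℝ) AffineMap.hasDerivAt_lineMap
  have hslope := hline.le_slope_of_hasDerivAt (Set.mem_univ 0) (Set.mem_univ 1)
    zero_lt_one hderiv
  simp only [slope_def_field, Function.comp_apply, AffineMap.lineMap_apply_one,
    AffineMap.lineMap_apply_zero, sub_zero, div_one] at hslope
  linarith

/-- The first-order optimality condition at a minimizer over a convex set. -/
theorem IsMinOn.inner_gradient_nonneg {φ : E → ℝ} {V : Set E} (hV : Convex ℝ V) {p v x : E}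
    (hmin : IsMinOn φ V p) (hv : HasGradientAt φ v p) (hp : p ∈ V) (hx : x ∈ V) :
    0 ≤ ⟪v, x - p⟫ := by
  simpa using hmin.localize.hasFDerivWithinAt_nonneg hv.hasFDerivAt.hasFDerivWithinAt
    (sub_mem_posTangentConeAt_of_segment_subset (hV.segment_subset hp hx))

/-- The three-point inequality for a Bregman proximal step with linear term `v`. -/
theorem bregman_three_point {h : E → ℝ} {G : E → E} {V : Set E} (hV : Convex ℝ V)
    {D : E → E → ℝ} (hD : ∀ x y, D x y = h x - h y - ⟪G y, x - y⟫) {γ : ℝ} {p v x y : E}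
    (hG : HasGradientAt h (G p) p) (hp : p ∈ V) (hx : x ∈ V)
    (hmin : ∀ z ∈ V, ⟪v, p - y⟫ + γ * D p y ≤ ⟪v, z - y⟫ + γ * D z y) :
    ⟪v, p - y⟫ + γ * D p y + γ * D x p ≤ ⟪v, x - y⟫ + γ * D x y := by
  have hgrad : HasGradientAt (fun z ↦ ⟪v, z - y⟫ + γ * D z y) (v + γ • (G p - G y)) p := by
    have hlin (w : E) : HasFDerivAt (fun z ↦ ⟪w, z - y⟫) (InnerProductSpace.toDual ℝ E w) p :=
      (InnerProductSpace.toDual ℝ E w).hasFDerivAt.comp p ((hasFDerivAt_id p).sub_const y)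
    simp only [hD]
    rw [hasGradientAt_iff_hasFDerivAt]
    refine ((hlin v).add
      (((hG.hasFDerivAt.sub_const (h y)).sub (hlin (G y))).const_mul γ)).congr_fderiv ?_
    ext w
    simp
  have hopt := IsMinOn.inner_gradient_nonneg hV (isMinOn_iff.mpr hmin) hgrad hp hx
  simp only [inner_add_left, real_inner_smul_left, inner_sub_left, inner_sub_right] at hopt
  simp only [hD, inner_sub_right]
  linarith

end Bregman

/-- Mirror descent with fixed step size `γ` on a convex function `f`
over a nonempty convex set `V`, with Bregman divergence `D_h` of a convex
differentiable kernel `h`, satisfying the per-iterate `γ`-Bregman condition,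
converges at rate `f(x(t)) − f(x*) ≤ (γ/t)·D_h(x*, x(0))`. -/
theorem mirror_descent_convergence (n : ℕ)
    (V : Set (EuclideanSpace ℝ (Fin n))) (hV_ne : V.Nonempty) (hV_cvx : Convex ℝ V)
    (f h : EuclideanSpace ℝ (Fin n) → ℝ)
    (hf : ConvexOn ℝ Set.univ f) (hh : ConvexOn ℝ Set.univ h)
    (gradh : EuclideanSpace ℝ (Fin n) → EuclideanSpace ℝ (Fin n))
    (hgradh : ∀ y, HasGradientAt h (gradh y) y)
    (Dh : EuclideanSpace ℝ (Fin n) → EuclideanSpace ℝ (Fin n) → ℝ)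
    (hDh : ∀ x y, Dh x y = h x - h y - ⟪gradh y, x - y⟫)
    (γ : ℝ) (hγ : 0 < γ)
    (xseq : ℕ → EuclideanSpace ℝ (Fin n)) (hxV : ∀ t, xseq t ∈ V)
    (g : ℕ → EuclideanSpace ℝ (Fin n))
    -- g(t) is a subgradient of f at x(t)
    (hsub : ∀ t, ∀ x, f (xseq t) + ⟪g t, x - xseq t⟫ ≤ f x)
    -- x(t+1) ∈ argmin_{x ∈ V} [ g(t)·(x − x(t)) + γ·D_h(x, x(t)) ]
    (hmin : ∀ t, ∀ x ∈ V,
        ⟪g t, xseq (t+1) - xseq t⟫ + γ * Dh (xseq (t+1)) (xseq t) ≤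
          ⟪g t, x - xseq t⟫ + γ * Dh x (xseq t))
    -- per-iterate γ-Bregman condition
    (hsmooth : ∀ t, f (xseq (t+1)) ≤
        f (xseq t) + ⟪g t, xseq (t+1) - xseq t⟫ + γ * Dh (xseq (t+1)) (xseq t))
    (xstar : EuclideanSpace ℝ (Fin n)) (hxstar : xstar ∈ V)
    (hopt : ∀ x ∈ V, f xstar ≤ f x) :
    ∀ t : ℕ, 1 ≤ t → f (xseq t) - f xstar ≤ (γ / t) * Dh xstar (xseq 0) := by
  have hstep (t : ℕ) :
      f (xseq (t + 1)) - f xstar + γ * Dh xstar (xseq (t + 1)) ≤ γ * Dh xstar (xseq t) := by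
    linarith [hsmooth t, hsub t xstar,
      bregman_three_point hV_cvx hDh (hgradh _) (hxV (t + 1)) hxstar (hmin t)]
  have hdesc (t : ℕ) : f (xseq (t + 1)) ≤ f (xseq t) := by
    have hself := hmin t (xseq t) (hxV t)
    simp only [hDh (xseq t) (xseq t), sub_self, inner_zero_right, mul_zero, add_zero] at hself
    linarith [hsmooth t]
  have hsum (t : ℕ) :
      t * (f (xseq t) - f xstar) + γ * Dh xstar (xseq t) ≤ γ * Dh xstar (xseq 0) := by
    induction t with
    | zero => simp
    | succ t ih =>
      push_cast
      linarith [hstep t, mul_le_mul_of_nonneg_left (hdesc t) (Nat.cast_nonneg (α := ℝ) t)]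
  intro t ht
  have hD_nonneg : 0 ≤ Dh xstar (xseq t) := by
    rw [hDh]
    linarith [hh.add_inner_gradient_le (hgradh (xseq t)) xstar]
  have ht_pos : (0 : ℝ) < t := by exact_mod_cast ht
  rw [div_mul_eq_mul_div, le_div_iff₀ ht_pos]
  linarith [hsum t, mul_nonneg hγ.le hD_nonneg]
end

section
/- Let p > 0 and let δ ∈ ℝ satisfy |δ| ≤ p/4. Then δ²/p ≤ (9/2)·KL(p + δ ‖ p), where KL(a ‖ b) = a·log(a/b) − a + b is the generalized Kullback–Leibler divergence; that is, δ²/p ≤ (9/2)·[ (p + δ)·log( (p + δ)/p ) − δ ]. -/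
/-- The squared Hellinger distance is bounded by the generalized Kullback–Leibler divergence. -/
theorem one_sub_sqrt_sq_le_mul_log {u : ℝ} (hu : 0 < u) :
    (1 - √u) ^ 2 ≤ u * Real.log u - u + 1 := by
  obtain ⟨s, hs, rfl⟩ : ∃ s : ℝ, 0 < s ∧ u = s ^ 2 :=
    ⟨√u, Real.sqrt_pos.2 hu, (Real.sq_sqrt hu.le).symm⟩
  have hlog : s ^ 2 * (1 - s⁻¹) ≤ s ^ 2 * Real.log s :=
    mul_le_mul_of_nonneg_left (Real.one_sub_inv_le_log_of_pos hs) (sq_nonneg s)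
  have hmul : s ^ 2 * (1 - s⁻¹) = s ^ 2 - s := by field_simp
  rw [Real.sqrt_sq hs.le, Real.log_pow]
  push_cast
  linarith

/-- For `p > 0` and `|δ| ≤ p/4`,
`δ²/p ≤ (9/2)·KL(p + δ ‖ p)` where `KL(a ‖ b) = a·log(a/b) − a + b`. -/
theorem sq_div_le_kl (p δ : ℝ) (hp : 0 < p) (hδ : |δ| ≤ p / 4) :
    δ ^ 2 / p ≤ (9 / 2) * ((p + δ) * Real.log ((p + δ) / p) - δ) := by
  obtain ⟨hlo, hhi⟩ := abs_le.1 hδ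
  obtain ⟨u, rfl⟩ : ∃ u, δ = p * (u - 1) := ⟨δ / p + 1, by field_simp; ring⟩
  have hu : 0 < u := by nlinarith
  have hu' : u ≤ 5 / 4 := by nlinarith
  have hkl := one_sub_sqrt_sq_le_mul_log hu
  have hsqrt : √u ≤ 28 / 25 := Real.sqrt_le_iff.2 ⟨by norm_num, by linarith⟩
  have hfactor : (1 + √u) ^ 2 ≤ 9 / 2 := by nlinarith [Real.sqrt_nonneg u]
  have hsq : (u - 1) ^ 2 ≤ 9 / 2 * (u * Real.log u - u + 1) := calc
    (u - 1) ^ 2 = (√u ^ 2 - 1) ^ 2 := by rw [Real.sq_sqrt hu.le]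
    _ = (1 + √u) ^ 2 * (1 - √u) ^ 2 := by ring
    _ ≤ 9 / 2 * (u * Real.log u - u + 1) := by gcongr
  have hdiv : (p + p * (u - 1)) / p = u := by field_simp; ring
  calc (p * (u - 1)) ^ 2 / p = p * (u - 1) ^ 2 := by field_simp
    _ ≤ p * (9 / 2 * (u * Real.log u - u + 1)) := by gcongr
    _ = 9 / 2 * ((p + p * (u - 1)) * Real.log ((p + p * (u - 1)) / p) - p * (u - 1)) := by
      rw [hdiv]; ring
end

section
/- Consider n buyers with utility functions u_i : ℝ^m → ℝ, each continuous, concave on the nonnegative orthant and positively homogeneous of degree 1 there, and budgets b_i > 0, such that for every price vector p with strictly positive entries the Marshallian demand M_i(p, b_i) is a singleton {m_i(p)}; let d_j(p) = Σ_{i=1}^n m_{ij}(p) denote aggregate demand for good j. Suppose the market is a gross complements market in the following sense: for every j, the aggregate demand d_j is antitone in prices, i.e. if p ≤ q coordinatewise (both with strictly positive entries) then d_j(q) ≤ d_j(p). Then for any two price vectors p, p' with strictly positive entries satisfying e^{−1/5}·p ≤ p' ≤ e^{1/5}·p coordinatewise, one has e^{−1/5}·d_j(p) ≤ d_j(p')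 ≤ e^{1/5}·d_j(p) for every good j. -/
/-- The indirect utility of a homogeneous utility is homogeneous of degree `-1` in prices. -/
theorem indirectUtil_smul {m : ℕ} {u : (Fin m → ℝ) → ℝ}
    (hu : ∀ c : ℝ, 0 < c → ∀ x : Fin m → ℝ, (∀ j, 0 ≤ x j) → u (c • x) = c * u x)
    {c : ℝ} (hc : 0 < c) (p : Fin m → ℝ) (b : ℝ) :
    indirectUtil u (c • p) b = c⁻¹ * indirectUtil u p b := by
  unfold indirectUtil
  rw [← smul_eq_mul, ← Real.sSup_smul_of_nonneg (inv_nonneg.2 hc.le)]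
  congr 1
  ext a
  simp only [Set.mem_smul_set, Set.mem_ofPred_eq]
  constructor
  · rintro ⟨x, hx, hxb, rfl⟩
    refine ⟨u (c • x), ⟨c • x, fun j => mul_nonneg hc.le (hx j), ?_, rfl⟩, ?_⟩
    · refine le_of_eq_of_le (Finset.sum_congr rfl fun j _ => ?_) hxb
      simp only [Pi.smul_apply, smul_eq_mul]
      ring
    · rw [hu c hc x hx, smul_eq_mul, inv_mul_cancel_left₀ hc.ne']
  · rintro ⟨_, ⟨x, hx, hxb, rfl⟩, rfl⟩
    refine ⟨c⁻¹ • x, fun j => mul_nonneg (inv_nonneg.2 hc.le) (hx j), ?_, ?_⟩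
    · refine le_of_eq_of_le (Finset.sum_congr rfl fun j _ => ?_) hxb
      simp only [Pi.smul_apply, smul_eq_mul]
      field_simp
    · rw [hu _ (inv_pos.2 hc) x hx, smul_eq_mul]

/-- Scaling all prices by `c` scales Marshallian demand for a homogeneous utility by `c⁻¹`. -/
theorem inv_smul_mem_marshallian {m : ℕ} {u : (Fin m → ℝ) → ℝ}
    (hu : ∀ c : ℝ, 0 < c → ∀ x : Fin m → ℝ, (∀ j, 0 ≤ x j) → u (c • x) = c * u x)
    {c : ℝ} (hc : 0 < c) {p x : Fin m → ℝ} {b : ℝ} (hx : x ∈ marshallian u p b) :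
    c⁻¹ • x ∈ marshallian u (c • p) b := by
  obtain ⟨hx0, hxb, hxu⟩ := hx
  refine ⟨fun j => mul_nonneg (inv_nonneg.2 hc.le) (hx0 j), ?_, ?_⟩
  · refine le_of_eq_of_le (Finset.sum_congr rfl fun j _ => ?_) hxb
    simp only [Pi.smul_apply, smul_eq_mul]
    field_simp
  · rw [hu _ (inv_pos.2 hc) x hx0, indirectUtil_smul hu hc, hxu]

/-- In a gross complements market (aggregate demand antitone in prices)
with singleton Marshallian demands, if prices move by a multiplicative factor of at
most `e^{±1/5}` coordinatewise, then each aggregate demand also changes by a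
multiplicative factor of at most `e^{±1/5}`. -/
theorem gross_complements_demand_change (n m : ℕ)
    (u : Fin n → (Fin m → ℝ) → ℝ) (b : Fin n → ℝ)
    (hu_cont : ∀ i, Continuous (u i))
    (hu_conc : ∀ i, ConcaveOn ℝ {x : Fin m → ℝ | ∀ j, 0 ≤ x j} (u i))
    (hu_hom : ∀ i, ∀ c : ℝ, 0 < c → ∀ x : Fin m → ℝ, (∀ j, 0 ≤ x j) →
        u i (c • x) = c * u i x)
    (hb : ∀ i, 0 < b i)
    (mi : Fin n → (Fin m → ℝ) → Fin m → ℝ)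
    -- Marshallian demands are singletons, given by `mi`
    (hmi : ∀ i, ∀ q : Fin m → ℝ, (∀ j, 0 < q j) →
        marshallian (u i) q (b i) = {mi i q})
    -- gross complements: aggregate demand for each good is antitone in prices
    (hgc : ∀ j : Fin m, ∀ q q' : Fin m → ℝ, (∀ k, 0 < q k) → (∀ k, 0 < q' k) →
        (∀ k, q k ≤ q' k) → (∑ i, mi i q' j) ≤ ∑ i, mi i q j)
    (p p' : Fin m → ℝ) (hp : ∀ j, 0 < p j) (hp' : ∀ j, 0 < p' j)
    (hclose : ∀ j, Real.exp (-(1 / 5)) * p j ≤ p' j ∧ p' j ≤ Real.exp (1 / 5) * p j) :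
    ∀ j, Real.exp (-(1 / 5)) * (∑ i, mi i p j) ≤ (∑ i, mi i p' j) ∧
      (∑ i, mi i p' j) ≤ Real.exp (1 / 5) * (∑ i, mi i p j) := by
  have scale : ∀ c : ℝ, 0 < c → ∀ j, ∑ i, mi i (c • p) j = c⁻¹ * ∑ i, mi i p j := by
    intro c hc j
    rw [Finset.mul_sum]
    refine Finset.sum_congr rfl fun i _ => ?_
    have hmem : mi i p ∈ marshallian (u i) p (b i) := by rw [hmi i p hp]; rfl
    have hmem' := inv_smul_mem_marshallian (hu_hom i) hc hmem
    rw [hmi i (c • p) fun j => mul_pos hc (hp j), Set.mem_singleton_iff] at hmem'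
    rw [← hmem', Pi.smul_apply, smul_eq_mul]
  intro j
  constructor
  · rw [Real.exp_neg, ← scale _ (Real.exp_pos _)]
    exact hgc j _ _ hp' (fun k => mul_pos (Real.exp_pos _) (hp k)) fun k => (hclose k).2
  · have h := hgc j _ _ (fun k => mul_pos (Real.exp_pos _) (hp k)) hp' fun k => (hclose k).1
    refine h.trans_eq ((scale _ (Real.exp_pos _) j).trans ?_)
    rw [← Real.exp_neg, neg_neg]
end
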